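/- Let N --k--> G --e--> H be a weakly Schreier extension with choices u : H → G (e(u_h) = h, u_1 = 1, every fibre element factoring as k(n) u_h) and let (∼, φ, χ) be the associated weakly Schreier datum, where n ∼ʰ n' iff k(n) u_h = k(n') u_h and k(φ(h,n)) u_h = u_h k(n), k(χ(h,h')) u_{h h'} = u_h u_{h'}. Let G(∼,φ,χ) be the monoid of pairs (h, [n]), [n] ∈ N/∼ʰ, with multiplication (h,[n])·(h',[n']) = (h h', [n φ(h,n') χ(h,h')]). Then the map t(h, [n]) := k(n) · u_h is well-defined (independent of the representative n) and is a monoid isomorphism G(∼,φ,χ) → G satisfying e(t(h,[n])) = h and t(1,[n]) = k(n). -/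

import Mathlib

/-- A weakly Schreier datum `(∼, φ, χ)` for monoids `H` and `N`: a family of
equivalence relations `∼ʰ` on `N` indexed by `h ∈ H` together with functions
`φ : H × N → N` and `χ : H × H → N` satisfying conditions (i)–(x). -/
structure WeaklySchreierDatum (H N : Type*) [Monoid H] [Monoid N] where
  sim : H → N → N → Prop
  /-- each `∼ʰ` is an equivalence relation -/
  equiv : ∀ h : H, Equivalence (sim h)
  /-- (i) each `∼ʰ` is a left congruence -/
  left_cong : ∀ (h : H) (n n₁ n₂ : N), sim h n₁ n₂ → sim h (n * n₁) (n * n₂)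
  /-- (ii) `∼¹` is equality -/
  sim_one : ∀ n₁ n₂ : N, sim 1 n₁ n₂ ↔ n₁ = n₂
  phi : H → N → N
  chi : H → H → N
  /-- (iii) `φ(1,n) = n` -/
  one_phi : ∀ n : N, phi 1 n = n
  /-- (iv) `φ(h,1) ∼ʰ 1` -/
  phi_one : ∀ h : H, sim h (phi h 1) 1
  /-- (v) `φ(h, n n') ∼ʰ φ(h,n) φ(h,n')` -/
  phi_mul : ∀ (h : H) (n n' : N), sim h (phi h (n * n')) (phi h n * phi h n')
  /-- (vi) `φ(h, φ(h',n)) χ(h,h') ∼^{h h'} χ(h,h') φ(h h', n)` -/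
  compat : ∀ (h h' : H) (n : N),
    sim (h * h') (phi h (phi h' n) * chi h h') (chi h h' * phi (h * h') n)
  /-- (vii) the combined congruence condition for the multiplication -/
  mul_cong : ∀ (h h' : H) (n₁ n₂ n'₁ n'₂ : N),
    sim h n₁ n₂ → sim h' n'₁ n'₂ →
      sim (h * h') (n₁ * phi h n'₁ * chi h h') (n₂ * phi h n'₂ * chi h h')
  /-- (viii) `n₁ ∼ʰ n₂` implies `n₁ χ(h,h') ∼^{h h'} n₂ χ(h,h')` -/
  chi_cong : ∀ (h h' : H) (n₁ n₂ : N),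
    sim h n₁ n₂ → sim (h * h') (n₁ * chi h h') (n₂ * chi h h')
  /-- (ix) `χ(1,h) ∼ʰ 1` and `χ(h,1) ∼ʰ 1` -/
  chi_one_left : ∀ h : H, sim h (chi 1 h) 1
  chi_one_right : ∀ h : H, sim h (chi h 1) 1
  /-- (x) the cocycle condition -/
  cocycle : ∀ x y z : H,
    sim (x * y * z) (chi x y * chi (x * y) z) (phi x (chi y z) * chi x (y * z))

variable {H N : Type*} [Monoid H] [Monoid N]

/-- The underlying set of `G(∼,φ,χ)`: pairs `(h, [n])` with `h ∈ H` and
`[n] ∈ N/∼ʰ`. -/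
def WSProd (D : WeaklySchreierDatum H N) : Type _ :=
  (h : H) × Quot (D.sim h)

/-- The multiplication `(h,[n]) · (h',[n']) = (h h', [n φ(h,n') χ(h,h')])` on
`G(∼,φ,χ)`; it is well defined by condition (vii). -/
def wsMul (D : WeaklySchreierDatum H N) (p q : WSProd D) : WSProd D :=
  ⟨p.1 * q.1,
    Quot.lift₂
      (fun n n' => Quot.mk (D.sim (p.1 * q.1)) (n * D.phi p.1 n' * D.chi p.1 q.1))
      (fun n n'₁ n'₂ hsim => Quot.sound
        (D.mul_cong p.1 q.1 n n n'₁ n'₂ ((D.equiv p.1).refl n) hsim))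
      (fun n₁ n₂ n' hsim => Quot.sound
        (D.mul_cong p.1 q.1 n₁ n₂ n' n' hsim ((D.equiv q.1).refl n')))
      p.2 q.2⟩

/-- The unit `(1, [1])` of `G(∼,φ,χ)`. -/
def wsOne (D : WeaklySchreierDatum H N) : WSProd D :=
  ⟨1, Quot.mk (D.sim 1) 1⟩

/-- Let N --k--> G --e--> H be a weakly Schreier extension with choices
`u : H → G`, and let `D = (∼, φ, χ)` be the associated weakly Schreier datum, where
`n ∼ʰ n' ↔ k(n) u_h = k(n') u_h`, `k(φ(h,n)) u_h = u_h k(n)` and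
`k(χ(h,h')) u_{hh'} = u_h u_{h'}`. Then `t(h, [n]) := k(n) · u_h` is well-defined and
is a monoid isomorphism `G(∼,φ,χ) → G` with `e(t(h,[n])) = h` and `t(1,[n]) = k(n)`. -/
theorem weakly_schreier_reconstruction_iso
    {G : Type*} [Monoid G]
    (k : N →* G) (e : G →* H)
    (hk : Function.Injective k) (he : Function.Surjective e)
    (hker : ∀ g : G, (∃ n : N, k n = g) ↔ e g = 1)
    (u : H → G) (hu : ∀ h : H, e (u h) = h) (hu1 : u 1 = 1)
    (hfac : ∀ (h : H) (g : G), e g = h → ∃ n : N, k n * u h = g)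
    (D : WeaklySchreierDatum H N)
    (hsim : ∀ (h : H) (n n' : N), D.sim h n n' ↔ k n * u h = k n' * u h)
    (hφ : ∀ (h : H) (n : N), k (D.phi h n) * u h = u h * k n)
    (hχ : ∀ h h' : H, k (D.chi h h') * u (h * h') = u h * u h') :
    ∃ t : WSProd D → G,
      -- t is well-defined and given on representatives by t(h, [n]) = k(n) · u_h
      (∀ (h : H) (n : N), t ⟨h, Quot.mk (D.sim h) n⟩ = k n * u h) ∧
        -- t is a bijection
        Function.Bijective t ∧
        -- t is a monoid homomorphism
        (∀ p q : WSProd D, t (wsMul D p q) = t p * t q) ∧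
        (t (wsOne D) = 1) ∧
        -- t commutes with the cokernel maps
        (∀ p : WSProd D, e (t p) = p.1) ∧
        -- t commutes with the kernel maps
        (∀ n : N, t ⟨1, Quot.mk (D.sim 1) n⟩ = k n) := by
  have hwd : ∀ (h : H) (a b : N), D.sim h a b → k a * u h = k b * u h :=
    fun h a b hab => (hsim h a b).1 hab
  refine ⟨fun p => Quot.lift (fun n => k n * u p.1) (hwd p.1) p.2, ?_, ⟨?_, ?_⟩, ?_, ?_, ?_, ?_⟩
  · intro h n
    rfl
  · rintro ⟨h, a⟩ ⟨h', b⟩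
    induction a using Quot.ind with | mk a => ?_
    induction b using Quot.ind with | mk b => ?_
    intro hab
    change k a * u h = k b * u h' at hab
    have hka : ∀ n : N, e (k n) = 1 := fun n => (hker (k n)).1 ⟨n, rfl⟩
    have hh : h = h' := by
      have := congrArg e hab
      simpa [hka, hu] using this
    subst hh
    exact congrArg (Sigma.mk h) (Quot.sound ((hsim h a b).2 hab))
  · intro g
    obtain ⟨n, hn⟩ := hfac (e g) g rfl
    exact ⟨⟨e g, Quot.mk _ n⟩, hn⟩
  · rintro ⟨h, a⟩ ⟨h', b⟩
    induction a using Quot.ind with | mk a => ?_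
    induction b using Quot.ind with | mk b => ?_
    change k (a * D.phi h b * D.chi h h') * u (h * h') = k a * u h * (k b * u h')
    rw [map_mul, map_mul, mul_assoc, hχ, mul_assoc, ← mul_assoc (k (D.phi h b)), hφ]
    simp only [mul_assoc]
  · change k 1 * u 1 = 1
    rw [map_one, hu1, one_mul]
  · rintro ⟨h, a⟩
    induction a using Quot.ind with | mk a => ?_
    change e (k a * u h) = h
    rw [map_mul, hu, (hker (k a)).1 ⟨a, rfl⟩, one_mul]
  · intro n
    change k n * u 1 = k n
    rw [hu1, mul_one]
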